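/- arXiv:0907.3188 — 3 statements merged into one kernel-verified Lean document; each statement's English description precedes it below -/
import Mathlib

section
/- If t is a positive integer with t ≡ 0, 2, 6, or 8 (mod 12), then c₃(t) = (t³ − 16t² + 76t − 96)/6. -/
/-- A 3×3 magic square with entries bounded above (strictly) by `t`: pairwise distinct
positive integer entries less than `t`, with all row sums, column sums, and both main
diagonal sums equal to one another. -/
def IsBoundedMagicSquare3 (t : ℕ) (M : Matrix (Fin 3) (Fin 3) ℕ) : Prop :=
  (∀ i j, 0 < M i j ∧ M i j < t) ∧
  (Function.Injective fun p : Fin 3 × Fin 3 => M p.1 p.2) ∧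
  ∃ s, (∀ i, ∑ j, M i j = s) ∧ (∀ j, ∑ i, M i j = s) ∧
    M 0 0 + M 1 1 + M 2 2 = s ∧ M 0 2 + M 1 1 + M 2 0 = s

/-- The number of 3×3 magic squares all of whose entries are less than `t`. -/
noncomputable def c3 (t : ℕ) : ℕ :=
  Set.ncard {M : Matrix (Fin 3) (Fin 3) ℕ | IsBoundedMagicSquare3 t M}

open Finset

/-- The values `a` for which `(a, s - a)` is a pair of absolute values of corner offsets with
sum `s` that gives a magic square with distinct entries. -/
def cornerOffsets (s : ℕ) : Finset ℕ :=
  (Ioo 0 s).filter fun a => 2 * a ≠ s ∧ 3 * a ≠ s ∧ 3 * a ≠ 2 * s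

theorem card_cornerOffsets {s : ℕ} (hs : 0 < s) :
    ((cornerOffsets s).card : ℤ) =
      s - 1 - (if 2 ∣ s then 1 else 0) - 2 * (if 3 ∣ s then 1 else 0) := by
  have key : cornerOffsets s = Ioo 0 s \
      ((if 2 ∣ s then {s / 2} else ∅) ∪ (if 3 ∣ s then {s / 3, 2 * (s / 3)} else ∅)) := by
    ext a
    simp only [cornerOffsets, mem_filter, mem_Ioo, mem_sdiff, mem_union]
    split_ifs <;> simp only [mem_singleton, mem_insert, notMem_empty, or_false, false_or,
      not_false_eq_true, and_true] <;> omega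
  have hsub : ((if 2 ∣ s then {s / 2} else ∅) ∪ (if 3 ∣ s then {s / 3, 2 * (s / 3)} else ∅)) ⊆
      Ioo 0 s := by
    intro a
    simp only [mem_Ioo, mem_union]
    split_ifs <;> simp only [mem_singleton, mem_insert, notMem_empty, or_false, false_or,
      false_imp_iff] <;> omega
  have hdisj : Disjoint (if 2 ∣ s then {s / 2} else (∅ : Finset ℕ))
      (if 3 ∣ s then {s / 3, 2 * (s / 3)} else ∅) := by
    rw [Finset.disjoint_left]
    intro a
    split_ifs <;> simp only [mem_singleton, mem_insert, notMem_empty,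
      not_false_eq_true, false_imp_iff, imp_true_iff]
    omega
  rw [key, cast_card_sdiff hsub, card_union_of_disjoint hdisj, Nat.card_Ioo]
  by_cases h2 : 2 ∣ s <;> by_cases h3 : 3 ∣ s <;> simp only [h2, h3, if_true, if_false]
  all_goals try rw [card_pair (by omega)]
  all_goals simp only [card_singleton, card_empty]
  all_goals omega

/-- The `3 × 3` magic square with centre `c` and upper corners `c + x` and `c + y`. -/
def magicSquareOf (c x y : ℤ) : Matrix (Fin 3) (Fin 3) ℕ :=
  !![(c + x).toNat, (c - x - y).toNat, (c + y).toNat;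
    (c - x + y).toNat, c.toNat, (c + x - y).toNat;
    (c - y).toNat, (c + x + y).toNat, (c - x).toNat]

theorem isBoundedMagicSquare3_magicSquareOf {t : ℕ} {c x y : ℤ} (hx : x ≠ 0) (hy : y ≠ 0)
    (hxy : x.natAbs ≠ y.natAbs) (hx2 : x.natAbs ≠ 2 * y.natAbs)
    (hy2 : y.natAbs ≠ 2 * x.natAbs) (hc : (x.natAbs + y.natAbs : ℤ) < c)
    (hct : c + x.natAbs + y.natAbs < t) : IsBoundedMagicSquare3 t (magicSquareOf c x y) := by
  refine ⟨?_, ?_, (3 * c).toNat, ?_, ?_, ?_, ?_⟩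
  · intro i j
    fin_cases i <;> fin_cases j <;> simp [magicSquareOf] <;> omega
  · rintro ⟨i, j⟩ ⟨k, l⟩ h
    fin_cases i <;> fin_cases j <;> fin_cases k <;> fin_cases l <;>
      first
      | rfl
      | (exfalso; simp [magicSquareOf] at h; omega)
  · intro i
    fin_cases i <;> simp [magicSquareOf, Fin.sum_univ_three] <;> omega
  · intro i
    fin_cases i <;> simp [magicSquareOf, Fin.sum_univ_three] <;> omega
  · simp [magicSquareOf]; omega
  · simp [magicSquareOf]; omega

theorem IsBoundedMagicSquare3.exists_eq_magicSquareOf {t : ℕ} {M : Matrix (Fin 3) (Fin 3) ℕ}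
    (hM : IsBoundedMagicSquare3 t M) :
    ∃ c x y : ℤ, x ≠ 0 ∧ y ≠ 0 ∧ x.natAbs ≠ y.natAbs ∧ x.natAbs ≠ 2 * y.natAbs ∧
      y.natAbs ≠ 2 * x.natAbs ∧ (x.natAbs + y.natAbs : ℤ) < c ∧
      c + x.natAbs + y.natAbs < t ∧ magicSquareOf c x y = M := by
  obtain ⟨hb, hinj, s, hr, hcol, hd, hd'⟩ := hM
  have ne : ∀ i j k l, (i, j) ≠ (k, l) → M i j ≠ M k l := fun i j k l h e => h (hinj e)
  simp only [Fin.sum_univ_three] at hr hcol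
  obtain ⟨e00, e01, e10, e12, e20, e21, e22⟩ :
      (M 0 0 : ℤ) = M 1 1 + (M 0 0 - M 1 1) ∧
      (M 0 1 : ℤ) = M 1 1 - (M 0 0 - M 1 1) - (M 0 2 - M 1 1) ∧
      (M 1 0 : ℤ) = M 1 1 - (M 0 0 - M 1 1) + (M 0 2 - M 1 1) ∧
      (M 1 2 : ℤ) = M 1 1 + (M 0 0 - M 1 1) - (M 0 2 - M 1 1) ∧
      (M 2 0 : ℤ) = M 1 1 - (M 0 2 - M 1 1) ∧
      (M 2 1 : ℤ) = M 1 1 + (M 0 0 - M 1 1) + (M 0 2 - M 1 1) ∧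
      (M 2 2 : ℤ) = M 1 1 - (M 0 0 - M 1 1) := by
    have r0 := hr 0
    have r1 := hr 1
    have r2 := hr 2
    have c0 := hcol 0
    have c1 := hcol 1
    have c2 := hcol 2
    refine ⟨?_, ?_, ?_, ?_, ?_, ?_, ?_⟩ <;> omega
  clear hr hcol hd hd'
  refine ⟨M 1 1, M 0 0 - M 1 1, M 0 2 - M 1 1, ?_, ?_, ?_, ?_, ?_, ?_, ?_, ?_⟩
  · have := ne 0 0 2 2 (by decide)
    omega
  · have := ne 0 2 2 0 (by decide)
    omega
  · have := ne 0 0 0 2 (by decide)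
    have := ne 0 0 2 0 (by decide)
    omega
  · have := ne 0 2 1 2 (by decide)
    have := ne 0 2 2 1 (by decide)
    have := ne 0 2 1 0 (by decide)
    have := ne 0 2 0 1 (by decide)
    omega
  · have := ne 0 0 1 2 (by decide)
    have := ne 0 0 2 1 (by decide)
    have := ne 0 0 1 0 (by decide)
    have := ne 0 0 0 1 (by decide)
    omega
  · have := hb 0 1
    have := hb 1 0
    have := hb 1 2
    have := hb 2 1
    omega
  · have := hb 0 1
    have := hb 1 0
    have := hb 1 2
    have := hb 2 1
    omega
  · ext i j
    fin_cases i <;> fin_cases j <;> simp [magicSquareOf] <;> omega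

theorem c3_two_mul (u : ℕ) :
    (c3 (2 * u) : ℤ) =
      4 * ∑ s ∈ range u, ((cornerOffsets s).card : ℤ) * (2 * u - 1 - 2 * s) := by
  let P : Finset ((_ : ℕ) × ((ℤ × ℤ) × ℕ × ℕ)) := (range u).sigma fun s =>
    (({1, -1} : Finset ℤ) ×ˢ ({1, -1} : Finset ℤ)) ×ˢ cornerOffsets s ×ˢ Ico (s + 1) (2 * u - s)
  let f : ((_ : ℕ) × ((ℤ × ℤ) × ℕ × ℕ)) → Matrix (Fin 3) (Fin 3) ℕ := fun p =>
    magicSquareOf p.2.2.2 (p.2.1.1 * p.2.2.1) (p.2.1.2 * (p.1 - p.2.2.1))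
  have hinj : Set.InjOn f P := by
    rintro ⟨s, ⟨e, d⟩, a, c⟩ hp ⟨s', ⟨e', d'⟩, a', c'⟩ hp' h
    simp only [P, cornerOffsets, coe_sigma, Set.mem_sigma_iff, mem_coe, mem_product, mem_insert,
      mem_singleton, mem_filter, mem_Ioo, mem_Ico, mem_range] at hp hp'
    have h00 := congrFun (congrFun h 0) 0
    have h02 := congrFun (congrFun h 0) 2
    have h11 := congrFun (congrFun h 1) 1
    simp [f, magicSquareOf] at h00 h02 h11
    obtain ⟨hs, ⟨he, hd⟩, ha, hc⟩ := hp
    obtain ⟨hs', ⟨he', hd'⟩, ha', hc'⟩ := hp'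
    have : e = e' ∧ d = d' ∧ a = a' ∧ s = s' := by
      rcases he with rfl | rfl <;> rcases hd with rfl | rfl <;> rcases he' with rfl | rfl <;>
        rcases hd' with rfl | rfl <;> omega
    obtain ⟨rfl, rfl, rfl, rfl⟩ := this
    rw [h11]
  have himg : {M | IsBoundedMagicSquare3 (2 * u) M} = Set.image f P := by
    ext M
    constructor
    · intro hM
      obtain ⟨c, x, y, hx, hy, h1, h2, h3, h4, h5, rfl⟩ := hM.exists_eq_magicSquareOf
      refine ⟨⟨x.natAbs + y.natAbs, (x.sign, y.sign), x.natAbs, c.toNat⟩, ?_, ?_⟩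
      · have sg : ∀ z : ℤ, z ≠ 0 → z.sign = 1 ∨ z.sign = -1 := fun z hz => by
          rcases lt_or_gt_of_ne hz with h | h
          · exact Or.inr (Int.sign_eq_neg_one_of_neg h)
          · exact Or.inl (Int.sign_eq_one_of_pos h)
        simp only [P, cornerOffsets, coe_sigma, Set.mem_sigma_iff, mem_coe, mem_product,
          mem_insert, mem_singleton, mem_filter, mem_Ioo, mem_Ico, mem_range]
        refine ⟨?_, ⟨sg x hx, sg y hy⟩, ?_, ?_⟩ <;> rw [Nat.cast_mul, Nat.cast_ofNat] at h5 <;> omega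
      · simp only [f]
        rw [Int.natCast_add, add_sub_cancel_left, Int.sign_mul_natAbs,
          Int.sign_mul_natAbs, Int.toNat_of_nonneg (by omega)]
    · rintro ⟨⟨s, ⟨e, d⟩, a, c⟩, hp, rfl⟩
      simp only [P, cornerOffsets, coe_sigma, Set.mem_sigma_iff, mem_coe, mem_product,
        mem_insert, mem_singleton, mem_filter, mem_Ioo, mem_Ico, mem_range] at hp
      obtain ⟨hs, ⟨he, hd⟩, ha, hc⟩ := hp
      have hea : (e * (a : ℤ)).natAbs = a := by rcases he with rfl | rfl <;> simp
      have hdb : (d * ((s : ℤ) - a)).natAbs = s - a := by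
        rcases hd with rfl | rfl <;> simp only [one_mul, neg_one_mul] <;> omega
      simp only [f]
      apply isBoundedMagicSquare3_magicSquareOf
      all_goals omega
  rw [c3, himg, hinj.ncard_image, Set.ncard_coe_finset, card_sigma, mul_sum]
  push_cast
  refine sum_congr rfl fun s hs => ?_
  rw [mem_range] at hs
  rw [card_product, card_product, card_product, card_pair (by decide), Nat.card_Ico]
  have : ((2 * u - s - (s + 1) : ℕ) : ℤ) = 2 * u - 1 - 2 * s := by omega
  push_cast
  rw [this]

theorem sum_card_cornerOffsets (k : ℕ) :
    ∑ s ∈ range (6 * k + 1), ((cornerOffsets s).card : ℤ) = 18 * k ^ 2 - 10 * k ∧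
    ∑ s ∈ range (6 * k + 1), (s : ℤ) * (cornerOffsets s).card =
      72 * k ^ 3 - 21 * k ^ 2 - 11 * k := by
  induction k with
  | zero => simp [cornerOffsets]
  | succ k ih =>
    obtain ⟨ih₁, ih₂⟩ := ih
    have h1 := card_cornerOffsets (s := 6 * k + 1) (by omega)
    have h2 := card_cornerOffsets (s := 6 * k + 2) (by omega)
    have h3 := card_cornerOffsets (s := 6 * k + 3) (by omega)
    have h4 := card_cornerOffsets (s := 6 * k + 4) (by omega)
    have h5 := card_cornerOffsets (s := 6 * k + 5) (by omega)
    have h6 := card_cornerOffsets (s := 6 * k + 6) (by omega)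
    rw [if_neg (by omega), if_neg (by omega)] at h1 h5
    rw [if_pos (by omega), if_neg (by omega)] at h2 h4
    rw [if_neg (by omega), if_pos (by omega)] at h3
    rw [if_pos (by omega), if_pos (by omega)] at h6
    rw [show 6 * (k + 1) + 1 = 6 * k + 6 + 1 by ring]
    constructor
    · iterate 6 rw [sum_range_succ]
      rw [ih₁, h1, h2, h3, h4, h5, h6]
      push_cast
      ring
    · iterate 6 rw [sum_range_succ]
      rw [ih₂, h1, h2, h3, h4, h5, h6]
      push_cast
      ring

theorem sum_card_cornerOffsets_mul (u : ℕ) (hu : 0 < u) (h : u % 3 = 0 ∨ u % 3 = 1) :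
    12 * ∑ s ∈ range u, ((cornerOffsets s).card : ℤ) * (2 * u - 1 - 2 * s) =
      4 * u ^ 3 - 32 * u ^ 2 + 76 * u - 48 := by
  have split (m : ℤ) (n : ℕ) : ∑ s ∈ range n, ((cornerOffsets s).card : ℤ) * (m - 2 * s) =
      m * ∑ s ∈ range n, ((cornerOffsets s).card : ℤ) -
        2 * ∑ s ∈ range n, (s : ℤ) * (cornerOffsets s).card := by
    rw [mul_sum, mul_sum, ← sum_sub_distrib]
    exact sum_congr rfl fun s _ => by ring
  obtain ⟨k, hk⟩ : ∃ k, u = 6 * k + 1 ∨ u = 6 * k + 3 ∨ u = 6 * k + 4 ∨ u = 6 * k + 6 :=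
    ⟨(u - 1) / 6, by omega⟩
  obtain ⟨ih₁, ih₂⟩ := sum_card_cornerOffsets k
  have h1 := card_cornerOffsets (s := 6 * k + 1) (by omega)
  have h2 := card_cornerOffsets (s := 6 * k + 2) (by omega)
  have h3 := card_cornerOffsets (s := 6 * k + 3) (by omega)
  have h4 := card_cornerOffsets (s := 6 * k + 4) (by omega)
  have h5 := card_cornerOffsets (s := 6 * k + 5) (by omega)
  rw [if_neg (by omega), if_neg (by omega)] at h1 h5
  rw [if_pos (by omega), if_neg (by omega)] at h2 h4
  rw [if_neg (by omega), if_pos (by omega)] at h3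
  rcases hk with rfl | rfl | rfl | rfl
  · rw [split, ih₁, ih₂]
    push_cast
    ring
  · rw [sum_range_succ, sum_range_succ, split, ih₁, ih₂, h1, h2]
    push_cast
    ring
  · rw [sum_range_succ, sum_range_succ, sum_range_succ, split, ih₁, ih₂, h1, h2, h3]
    push_cast
    ring
  · rw [sum_range_succ, sum_range_succ, sum_range_succ, sum_range_succ, sum_range_succ, split,
      ih₁, ih₂, h1, h2, h3, h4, h5]
    push_cast
    ring

theorem c3_formula_mod12_0_2_6_8 (t : ℕ) (ht : 0 < t) (h : t % 12 = 0 ∨ t % 12 = 2 ∨ t % 12 = 6 ∨ t % 12 = 8) :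
    (c3 t : ℚ) = ((t : ℚ) ^ 3 - 16 * (t : ℚ) ^ 2 + 76 * (t : ℚ) - 96) / 6 := by
  obtain ⟨u, rfl⟩ : 2 ∣ t := by omega
  have h₁ := c3_two_mul u
  have h₂ := sum_card_cornerOffsets_mul u (by omega) (by omega)
  have h₃ : 3 * (c3 (2 * u) : ℤ) = 4 * u ^ 3 - 32 * u ^ 2 + 76 * u - 48 := by linarith
  have h₄ : 3 * (c3 (2 * u) : ℚ) = 4 * u ^ 3 - 32 * u ^ 2 + 76 * u - 48 := by exact_mod_cast h₃
  push_cast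
  linarith
end

section
/- If t is a positive integer with t ≡ 1 (mod 12), then c₃(t) = (t³ − 16t² + 73t − 58)/6. -/
/-- The 3×3 square with centre `e` and upper corners `e + u`, `e + v` whose lines all sum
to `3 * e`. -/
def magicOf (e u v : ℤ) : Matrix (Fin 3) (Fin 3) ℕ :=
  !![(e + u).toNat, (e - u - v).toNat, (e + v).toNat;
     (e - u + v).toNat, e.toNat, (e + u - v).toNat;
     (e - v).toNat, (e + u + v).toNat, (e - u).toNat]

/-- The admissible parameters `(e, u, v)` for magic squares with entries below `t`. -/
def IsMagicParam (t : ℕ) (e u v : ℤ) : Prop :=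
  (u.natAbs + v.natAbs < e ∧ e + u.natAbs + v.natAbs < t) ∧
    u ≠ 0 ∧ v ≠ 0 ∧ u.natAbs ≠ v.natAbs ∧ u.natAbs ≠ 2 * v.natAbs ∧ v.natAbs ≠ 2 * u.natAbs

lemma injective_of_nodup {x00 x01 x02 x10 x11 x12 x20 x21 x22 : ℕ}
    (h : [x00, x01, x02, x10, x11, x12, x20, x21, x22].Nodup) :
    Function.Injective fun p : Fin 3 × Fin 3 =>
      !![x00, x01, x02; x10, x11, x12; x20, x21, x22] p.1 p.2 := by
  have hget : ∀ i j : Fin 3, !![x00, x01, x02; x10, x11, x12; x20, x21, x22] i j =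
      [x00, x01, x02, x10, x11, x12, x20, x21, x22].get (finProdFinEquiv (i, j)) := by
    intro i j
    fin_cases i <;> fin_cases j <;> rfl
  intro p q hpq
  simp only [hget] at hpq
  exact finProdFinEquiv.injective (h.injective_get hpq)

set_option maxHeartbeats 1000000 in
lemma nodup_entries {e u v : ℤ} {x00 x01 x02 x10 x11 x12 x20 x21 x22 : ℕ}
    (hu : u ≠ 0) (hv : v ≠ 0)
    (hne : u ≠ v ∧ u ≠ -v ∧ u ≠ 2 * v ∧ u ≠ -(2 * v) ∧ v ≠ 2 * u ∧ v ≠ -(2 * u))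
    (a00 : (x00 : ℤ) = e + u) (a01 : (x01 : ℤ) = e - u - v) (a02 : (x02 : ℤ) = e + v)
    (a10 : (x10 : ℤ) = e - u + v) (a11 : (x11 : ℤ) = e) (a12 : (x12 : ℤ) = e + u - v)
    (a20 : (x20 : ℤ) = e - v) (a21 : (x21 : ℤ) = e + u + v) (a22 : (x22 : ℤ) = e - u) :
    [x00, x01, x02, x10, x11, x12, x20, x21, x22].Nodup := by
  simp only [List.nodup_cons, List.mem_cons, List.not_mem_nil, or_false, not_or,
    List.nodup_nil, and_true, not_false_eq_true]
  obtain ⟨n1, n2, n3, n4, n5, n6⟩ := hne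
  refine ⟨⟨?_, ?_, ?_, ?_, ?_, ?_, ?_, ?_⟩, ⟨?_, ?_, ?_, ?_, ?_, ?_, ?_⟩,
    ⟨?_, ?_, ?_, ?_, ?_, ?_⟩, ⟨?_, ?_, ?_, ?_, ?_⟩, ⟨?_, ?_, ?_, ?_⟩, ⟨?_, ?_, ?_⟩,
    ⟨?_, ?_⟩, ?_⟩ <;> intro hE <;>
    first
      | exact hu (by linarith) | exact hv (by linarith) | exact n1 (by linarith)
      | exact n2 (by linarith) | exact n3 (by linarith) | exact n4 (by linarith)
      | exact n5 (by linarith) | exact n6 (by linarith)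

lemma isBoundedMagicSquare3_magicOf {t : ℕ} {e u v : ℤ} (h : IsMagicParam t e u v) :
    IsBoundedMagicSquare3 t (magicOf e u v) := by
  obtain ⟨⟨h1, h2⟩, h3, h4, h5, h6, h7⟩ := h
  have hpos : ∀ x : ℤ, 0 < x ∧ x < t → (0 < x.toNat ∧ x.toNat < t) ∧ (x.toNat : ℤ) = x := by
    clear * -
    omega
  have hne : u ≠ v ∧ u ≠ -v ∧ u ≠ 2 * v ∧ u ≠ -(2 * v) ∧ v ≠ 2 * u ∧ v ≠ -(2 * u) := by
    clear h1 h2 h3 h4 hpos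
    omega
  clear h5 h6 h7
  have a00 := hpos (e + u) (by clear * - h1 h2; omega)
  have a01 := hpos (e - u - v) (by clear * - h1 h2; omega)
  have a02 := hpos (e + v) (by clear * - h1 h2; omega)
  have a10 := hpos (e - u + v) (by clear * - h1 h2; omega)
  have a11 := hpos e (by clear * - h1 h2; omega)
  have a12 := hpos (e + u - v) (by clear * - h1 h2; omega)
  have a20 := hpos (e - v) (by clear * - h1 h2; omega)
  have a21 := hpos (e + u + v) (by clear * - h1 h2; omega)
  have a22 := hpos (e - u) (by clear * - h1 h2; omega)
  clear hpos h1 h2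
  unfold magicOf
  generalize (e + u).toNat = x00 at *
  generalize (e - u - v).toNat = x01 at *
  generalize (e + v).toNat = x02 at *
  generalize (e - u + v).toNat = x10 at *
  generalize e.toNat = x11 at *
  generalize (e + u - v).toNat = x12 at *
  generalize (e - v).toNat = x20 at *
  generalize (e + u + v).toNat = x21 at *
  generalize (e - u).toNat = x22 at *
  refine ⟨?_, ?_, 3 * x11, ?_, ?_, ?_, ?_⟩
  · intro i j
    fin_cases i <;> fin_cases j
    exacts [a00.1, a01.1, a02.1, a10.1, a11.1, a12.1, a20.1, a21.1, a22.1]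
  · exact injective_of_nodup
      (nodup_entries h3 h4 hne a00.2 a01.2 a02.2 a10.2 a11.2 a12.2 a20.2 a21.2 a22.2)
  · clear h3 h4 hne
    intro i
    fin_cases i <;> simp [Fin.sum_univ_three] <;> omega
  · clear h3 h4 hne
    intro j
    fin_cases j <;> simp [Fin.sum_univ_three] <;> omega
  · clear h3 h4 hne
    simp
    omega
  · clear h3 h4 hne
    simp
    omega

lemma IsBoundedMagicSquare3.exists_param {t : ℕ} {M : Matrix (Fin 3) (Fin 3) ℕ}
    (h : IsBoundedMagicSquare3 t M) :
    ∃ e u v, IsMagicParam t e u v ∧ magicOf e u v = M := by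
  obtain ⟨hb, hinj, s, hr, hc, hd, hd'⟩ := h
  have ne : ∀ i j k l, (i, j) ≠ (k, l) → M i j ≠ M k l := fun i j k l hne hE => hne (hinj hE)
  have r0 := hr 0
  have r1 := hr 1
  have r2 := hr 2
  have c0 := hc 0
  have c1 := hc 1
  have c2 := hc 2
  simp only [Fin.sum_univ_three] at r0 r1 r2 c0 c1 c2
  have n1 := ne 0 0 1 1 (by decide)
  have n2 := ne 0 2 1 1 (by decide)
  have n3 := ne 0 0 0 2 (by decide)
  have n4 := ne 0 0 2 0 (by decide)
  have n5 := ne 0 1 0 0 (by decide)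
  have n6 := ne 1 0 0 0 (by decide)
  have n7 := ne 1 2 0 2 (by decide)
  have n8 := ne 0 1 0 2 (by decide)
  have b01 := hb 0 1
  have b10 := hb 1 0
  have b12 := hb 1 2
  have b21 := hb 2 1
  clear hb hinj hr hc ne
  have e01 : (M 0 1 : ℤ) = 3 * M 1 1 - M 0 0 - M 0 2 := by omega
  have e10 : (M 1 0 : ℤ) = M 1 1 - M 0 0 + M 0 2 := by omega
  have e12 : (M 1 2 : ℤ) = M 1 1 + M 0 0 - M 0 2 := by omega
  have e20 : (M 2 0 : ℤ) = 2 * M 1 1 - M 0 2 := by omega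
  have e21 : (M 2 1 : ℤ) = M 0 0 + M 0 2 - M 1 1 := by omega
  have e22 : (M 2 2 : ℤ) = 2 * M 1 1 - M 0 0 := by omega
  clear r0 r1 r2 c0 c1 c2 hd hd'
  refine ⟨M 1 1, M 0 0 - M 1 1, M 0 2 - M 1 1, ⟨⟨?_, ?_⟩, ?_, ?_, ?_, ?_, ?_⟩, ?_⟩
  iterate 7 omega
  ext i j
  fin_cases i <;> fin_cases j <;> simp [magicOf] <;> omega

lemma magicOf_injective {t : ℕ} {e u v e' u' v' : ℤ} (h : IsMagicParam t e u v)
    (h' : IsMagicParam t e' u' v') (hE : magicOf e u v = magicOf e' u' v') :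
    e = e' ∧ u = u' ∧ v = v' := by
  have h00 := congrFun (congrFun hE 0) 0
  have h11 := congrFun (congrFun hE 1) 1
  have h02 := congrFun (congrFun hE 0) 2
  simp [magicOf] at h00 h11 h02
  obtain ⟨⟨h1, -⟩, -⟩ := h
  obtain ⟨⟨h1', -⟩, -⟩ := h'
  omega

/-- The `a` for which `(a, s - a)` are the absolute values of admissible corner deviations. -/
def shell (s : ℕ) : Finset ℕ :=
  (Finset.Ioo 0 s).filter fun a => 2 * a ≠ s ∧ 3 * a ≠ s ∧ 3 * a ≠ 2 * s

lemma card_shell (q : ℕ) :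
    (shell (6 * q + 6)).card = 6 * q + 2 ∧ (shell (6 * q + 1)).card = 6 * q ∧
    (shell (6 * q + 2)).card = 6 * q ∧ (shell (6 * q + 3)).card = 6 * q ∧
    (shell (6 * q + 4)).card = 6 * q + 2 ∧ (shell (6 * q + 5)).card = 6 * q + 4 := by
  have key : ∀ (s : ℕ) (B : Finset ℕ),
      (∀ a, a ∈ B ↔ a ∈ Finset.Ioo 0 s ∧ (2 * a = s ∨ 3 * a = s ∨ 3 * a = 2 * s)) →
      (shell s).card = s - 1 - B.card := by
    intro s B h
    have : shell s = Finset.Ioo 0 s \ B := by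
      ext a
      simp only [shell, Finset.mem_filter, Finset.mem_sdiff, h]
      tauto
    rw [this, Finset.card_sdiff_of_subset fun a ha => ((h a).1 ha).1, Nat.card_Ioo, Nat.sub_zero]
  refine ⟨?_, ?_, ?_, ?_, ?_, ?_⟩
  · have h3 : ({3 * q + 3, 2 * q + 2, 4 * q + 4} : Finset ℕ).card = 3 :=
      Finset.card_eq_three.2 ⟨3 * q + 3, 2 * q + 2, 4 * q + 4, by omega, by omega, by omega, rfl⟩
    rw [key _ {3 * q + 3, 2 * q + 2, 4 * q + 4}
      (by intro a
          simp only [Finset.mem_insert, Finset.mem_singleton, Finset.mem_Ioo]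
          constructor <;> intro _ <;> omega), h3]
    omega
  · rw [key _ ∅ (by intro a; simp only [Finset.notMem_empty, Finset.mem_Ioo, false_iff]; omega)]
    simp
  · rw [key _ {3 * q + 1}
      (by intro a; simp only [Finset.mem_singleton, Finset.mem_Ioo]; omega)]
    simp
  · have h2 : 2 * q + 1 ≠ 4 * q + 2 := by omega
    rw [key _ {2 * q + 1, 4 * q + 2}
      (by intro a
          simp only [Finset.mem_insert, Finset.mem_singleton, Finset.mem_Ioo]
          constructor <;> intro _ <;> omega),
      Finset.card_pair h2]
    omega
  · rw [key _ {3 * q + 2}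
      (by intro a; simp only [Finset.mem_singleton, Finset.mem_Ioo]; omega)]
    simp
  · rw [key _ ∅ (by intro a; simp only [Finset.notMem_empty, Finset.mem_Ioo, false_iff]; omega)]
    simp

/-- The integer with absolute value `a` and the sign encoded by `b`. -/
def withSign (b : Bool) (a : ℕ) : ℤ := if b then a else -a

/-- Codes `(e - 1, |u| + |v|, |u|, sign u, sign v)` of the admissible parameters for entries
at most `n`. -/
def paramCodes (n : ℕ) : Finset (Σ _ : ℕ, Σ _ : ℕ, ℕ × Bool × Bool) :=
  (Finset.range n).sigma fun f =>
    (Finset.range (min f (n - 1 - f) + 1)).sigma fun s => shell s ×ˢ Finset.univ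

/-- The magic square with a given code. -/
def magicOfCode (p : Σ _ : ℕ, Σ _ : ℕ, ℕ × Bool × Bool) : Matrix (Fin 3) (Fin 3) ℕ :=
  magicOf (p.1 + 1) (withSign p.2.2.2.1 p.2.2.1) (withSign p.2.2.2.2 (p.2.1 - p.2.2.1))

lemma isMagicParam_of_mem_paramCodes {n f s a : ℕ} {σ τ : Bool}
    (h : ⟨f, s, a, σ, τ⟩ ∈ paramCodes n) :
    a < s ∧ 0 < a ∧ IsMagicParam (n + 1) (f + 1) (withSign σ a) (withSign τ (s - a)) := by
  simp only [paramCodes, shell, Finset.mem_sigma, Finset.mem_range, Finset.mem_product,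
    Finset.mem_filter, Finset.mem_Ioo] at h
  have natAbs_withSign : ∀ b c, (withSign b c).natAbs = c := by
    intro b c
    cases b <;> simp [withSign]
  obtain ⟨hf, hs, ⟨ha, h2⟩, -⟩ := h
  refine ⟨ha.2, ha.1, ?_⟩
  rw [IsMagicParam, ← Int.natAbs_ne_zero (a := withSign σ a),
    ← Int.natAbs_ne_zero (a := withSign τ (s - a)), natAbs_withSign, natAbs_withSign]
  omega

lemma exists_withSign (u : ℤ) : ∃ σ, withSign σ u.natAbs = u := by
  rcases le_total 0 u with h | h
  · exact ⟨true, by simp [withSign, h]⟩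
  · exact ⟨false, by simp [withSign, abs_of_nonpos h]⟩

lemma withSign_inj {σ τ : Bool} {a b : ℕ} (ha : 0 < a)
    (h : withSign σ a = withSign τ b) : σ = τ ∧ a = b := by
  cases σ <;> cases τ <;> simp [withSign] at h ⊢ <;> omega

lemma c3_eq_card_paramCodes (n : ℕ) : c3 (n + 1) = (paramCodes n).card := by
  have hinj : Set.InjOn magicOfCode (paramCodes n : Set (Σ _ : ℕ, Σ _ : ℕ, ℕ × Bool × Bool)) := by
    rintro ⟨f, s, a, σ, τ⟩ hp ⟨f', s', a', σ', τ'⟩ hp' hE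
    obtain ⟨h1, h2, h3⟩ := isMagicParam_of_mem_paramCodes (Finset.mem_coe.1 hp)
    obtain ⟨h1', h2', h3'⟩ := isMagicParam_of_mem_paramCodes (Finset.mem_coe.1 hp')
    obtain ⟨he, hu, hv⟩ := magicOf_injective h3 h3' hE
    obtain ⟨rfl, rfl⟩ := withSign_inj h2 hu
    obtain ⟨rfl, hs⟩ := withSign_inj (by omega) hv
    obtain rfl : f = f' := by omega
    obtain rfl : s = s' := by omega
    rfl
  rw [c3, ← Set.ncard_coe_finset, ← hinj.ncard_image]
  congr 1
  ext M
  simp only [Set.mem_ofPred_eq, Set.mem_image, Finset.mem_coe]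
  constructor
  · intro hM
    obtain ⟨e, u, v, hp, rfl⟩ := hM.exists_param
    obtain ⟨⟨h1, h2⟩, h3, h4, h5, h6, h7⟩ := hp
    obtain ⟨σ, hσ⟩ := exists_withSign u
    obtain ⟨τ, hτ⟩ := exists_withSign v
    refine ⟨⟨(e - 1).toNat, u.natAbs + v.natAbs, u.natAbs, σ, τ⟩, ?_, ?_⟩
    · simp only [paramCodes, shell, Finset.mem_sigma, Finset.mem_range, Finset.mem_product,
        Finset.mem_filter, Finset.mem_Ioo, Finset.mem_univ, and_true]
      omega
    · simp only [magicOfCode, Nat.add_sub_cancel_left, hσ, hτ]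
      congr 1
      omega
  · rintro ⟨⟨f, s, a, σ, τ⟩, hp, rfl⟩
    exact isBoundedMagicSquare3_magicOf (isMagicParam_of_mem_paramCodes hp).2.2

lemma card_paramCodes (n : ℕ) : (paramCodes n).card =
    4 * ∑ f ∈ Finset.range n, ∑ s ∈ Finset.range (min f (n - 1 - f) + 1), (shell s).card := by
  simp [paramCodes, Finset.card_sigma, Finset.mul_sum, mul_comm]

lemma sum_range_two_mul_min (g : ℕ → ℕ) (k : ℕ) :
    ∑ f ∈ Finset.range (2 * k), g (min f (2 * k - 1 - f)) = 2 * ∑ f ∈ Finset.range k, g f := by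
  rw [two_mul k, Finset.sum_range_add, two_mul, ← Finset.sum_range_reflect g]
  nth_rewrite 3 [← Finset.sum_range_reflect]
  congr 1 <;> refine Finset.sum_congr rfl fun f hf => ?_ <;> congr 1 <;>
    have := Finset.mem_range.1 hf <;> omega

lemma sum_card_shell (k : ℕ) :
    (∑ s ∈ Finset.range (6 * k + 7), (shell s).card = 18 * k ^ 2 + 26 * k + 8) ∧
    (∑ m ∈ Finset.range (6 * k + 6), ∑ s ∈ Finset.range (m + 1), (shell s).card) =
      36 * k ^ 3 + 69 * k ^ 2 + 41 * k + 8 := by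
  induction k with
  | zero => decide
  | succ k ih =>
    obtain ⟨ih1, ih2⟩ := ih
    obtain ⟨h6, -⟩ := card_shell k
    obtain ⟨h0, h1, h2, h3, h4, h5⟩ := card_shell (k + 1)
    simp only [mul_add_one, add_assoc, Nat.reduceAdd] at h0 h1 h2 h3 h4 h5 ⊢
    simp only [Finset.sum_range_succ] at ih1 ih2 ⊢
    constructor <;> linarith

theorem c3_formula_mod12_1 (t : ℕ) (ht : 0 < t) (h : t % 12 = 1) :
    (c3 t : ℚ) = ((t : ℚ) ^ 3 - 16 * (t : ℚ) ^ 2 + 73 * (t : ℚ) - 58) / 6 := by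
  obtain ⟨k, rfl⟩ : ∃ k, t = 2 * (6 * k) + 1 := ⟨t / 12, by omega⟩
  rw [c3_eq_card_paramCodes, card_paramCodes,
    sum_range_two_mul_min fun m => ∑ s ∈ Finset.range (m + 1), (shell s).card]
  cases k with
  | zero => norm_num
  | succ k =>
    rw [mul_add_one, (sum_card_shell k).2]
    push_cast
    ring
end

section
/- As an identity of formal power series over the rationals, (1 − x³)(1 − x⁶)(1 − x⁹) · Σ_{t≥0} a₃(t) xᵗ = 8x¹⁵(2x³ + 1); equivalently, the generating function Σ_{t≥0} a₃(t) xᵗ equals 8x¹⁵(2x³ + 1) / ((1 − x³)(1 − x⁶)(1 − x⁹)). -/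
/-- A 3×3 magic square with magic sum `t`: pairwise distinct positive integer entries,
all row sums, column sums, and both main diagonal sums equal to `t`. -/
def IsMagicSquare3 (t : ℕ) (M : Matrix (Fin 3) (Fin 3) ℕ) : Prop :=
  (∀ i j, 0 < M i j) ∧
  (Function.Injective fun p : Fin 3 × Fin 3 => M p.1 p.2) ∧
  (∀ i, ∑ j, M i j = t) ∧
  (∀ j, ∑ i, M i j = t) ∧
  M 0 0 + M 1 1 + M 2 2 = t ∧
  M 0 2 + M 1 1 + M 2 0 = t

/-- The number of 3×3 magic squares with magic sum `t`. -/
noncomputable def a3 (t : ℕ) : ℕ := Set.ncard {M : Matrix (Fin 3) (Fin 3) ℕ | IsMagicSquare3 t M}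

namespace MagicSquare3

/-- The pairs `(a, b)` for which the magic square with centre `c` and top corners `c + a`, `c + b`
has distinct entries. -/
def Nondegenerate (p : ℤ × ℤ) : Prop :=
  p.1 ≠ 0 ∧ p.2 ≠ 0 ∧ p.1 ≠ p.2 ∧ p.1 ≠ -p.2 ∧ p.1 ≠ 2 * p.2 ∧ p.1 ≠ -(2 * p.2) ∧
    p.2 ≠ 2 * p.1 ∧ p.2 ≠ -(2 * p.1)

instance : DecidablePred Nondegenerate := fun _ => inferInstanceAs (Decidable (_ ∧ _))

/-- Corner offsets of the magic squares with centre `c`. -/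
noncomputable def offsets (c : ℕ) : Finset (ℤ × ℤ) :=
  {p ∈ Finset.Icc (-c : ℤ) c ×ˢ Finset.Icc (-c : ℤ) c | p.1.natAbs + p.2.natAbs < c ∧ Nondegenerate p}

/-- Corner offsets of the magic squares with centre `c + 1` and least entry `1`. -/
noncomputable def shell (c : ℕ) : Finset (ℤ × ℤ) :=
  {p ∈ Finset.Icc (-c : ℤ) c ×ˢ Finset.Icc (-c : ℤ) c | p.1.natAbs + p.2.natAbs = c ∧ Nondegenerate p}

/-- Absolute values of the first coordinates of the elements of `shell c`. -/
def shellAbs (c : ℕ) : Finset ℕ :=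
  {a ∈ Finset.Ioo 0 c | 2 * a ≠ c ∧ 3 * a ≠ c ∧ 3 * a ≠ 2 * c}

lemma mem_offsets {c : ℕ} {p : ℤ × ℤ} :
    p ∈ offsets c ↔ p.1.natAbs + p.2.natAbs < c ∧ Nondegenerate p := by
  simp only [offsets, Finset.mem_filter, Finset.mem_product, Finset.mem_Icc, and_iff_right_iff_imp]
  rintro ⟨h, -⟩
  omega

lemma mem_shell {c : ℕ} {p : ℤ × ℤ} :
    p ∈ shell c ↔ p.1.natAbs + p.2.natAbs = c ∧ Nondegenerate p := by
  simp only [shell, Finset.mem_filter, Finset.mem_product, Finset.mem_Icc, and_iff_right_iff_imp]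
  rintro ⟨h, -⟩
  omega

lemma card_offsets_succ (c : ℕ) :
    (offsets (c + 1)).card = (offsets c).card + (shell c).card := by
  rw [← Finset.card_union_of_disjoint]
  · congr 1
    ext p
    rw [Finset.mem_union, mem_offsets, mem_offsets, mem_shell, ← or_and_right]
    refine and_congr_left fun _ => ?_
    omega
  · rw [Finset.disjoint_left]
    intro p hp hq
    rw [mem_offsets] at hp
    rw [mem_shell] at hq
    omega

lemma card_shell (c : ℕ) : (shell c).card = 4 * (shellAbs c).card := by
  have h : (shell c).card =
      ((({1, -1} : Finset ℤ) ×ˢ ({1, -1} : Finset ℤ)) ×ˢ shellAbs c).card := by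
    refine Finset.card_nbij' (fun p => ((p.1.sign, p.2.sign), p.1.natAbs))
      (fun x => (x.1.1 * (x.2 : ℤ), x.1.2 * ((c : ℤ) - x.2))) ?_ ?_ ?_ ?_
    · rintro ⟨a, b⟩ h
      simp only [Finset.mem_coe, mem_shell, Nondegenerate, Finset.mem_product, Finset.mem_insert,
        Finset.mem_singleton, shellAbs, Finset.mem_filter, Finset.mem_Ioo, Int.sign_eq_one_iff_pos,
        Int.sign_eq_neg_one_iff_neg] at h ⊢
      omega
    · rintro ⟨⟨s, t⟩, a⟩ h
      simp only [Finset.mem_coe, mem_shell, Nondegenerate, Finset.mem_product, Finset.mem_insert,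
        Finset.mem_singleton, shellAbs, Finset.mem_filter, Finset.mem_Ioo] at h ⊢
      obtain ⟨⟨rfl | rfl, rfl | rfl⟩, h⟩ := h <;> omega
    · rintro ⟨a, b⟩ h
      simp only [Finset.mem_coe, mem_shell] at h
      have hb : (c : ℤ) - a.natAbs = b.natAbs := by omega
      simp only [hb, Int.sign_mul_natAbs]
    · rintro ⟨⟨s, t⟩, a⟩ h
      simp only [Finset.mem_coe, Finset.mem_product, Finset.mem_insert,
        Finset.mem_singleton, shellAbs, Finset.mem_filter, Finset.mem_Ioo] at h
      have ha : (a : ℤ).sign = 1 := Int.sign_eq_one_iff_pos.2 (by omega)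
      have hb : ((c : ℤ) - a).sign = 1 := Int.sign_eq_one_iff_pos.2 (by omega)
      obtain ⟨⟨rfl | rfl, rfl | rfl⟩, h⟩ := h <;>
        simp [ha, hb, -neg_sub]
  rw [h, Finset.card_product, Finset.card_product]
  rfl

lemma card_shellAbs (c : ℕ) :
    (shellAbs c).card = c - 1 - (if c % 2 = 0 then 1 else 0) - (if c % 3 = 0 then 2 else 0) := by
  rcases Nat.eq_zero_or_pos c with rfl | hc
  · rfl
  have h : shellAbs c = Finset.Ioo 0 c \ ((if c % 2 = 0 then {c / 2} else ∅) ∪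
      (if c % 3 = 0 then {c / 3, 2 * (c / 3)} else ∅)) := by
    ext a
    simp only [shellAbs, Finset.mem_filter, Finset.mem_sdiff, Finset.mem_union]
    split_ifs <;> simp <;> omega
  rw [h, Finset.card_sdiff_of_subset, Finset.card_union_of_disjoint, Nat.card_Ioo]
  · split_ifs
    · rw [Finset.card_pair (by omega), Finset.card_singleton]; omega
    · simp
    · rw [Finset.card_pair (by omega), Finset.card_empty]; omega
    · simp
  · rw [Finset.disjoint_left]
    split_ifs <;> simp
    omega
  · intro a
    simp only [Finset.mem_union, Finset.mem_Ioo]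
    split_ifs <;> simp <;> omega

lemma isMagicSquare3_iff (t : ℕ) (M : Matrix (Fin 3) (Fin 3) ℕ) :
    IsMagicSquare3 t M ↔
      (∀ i j, 0 < M i j) ∧ (Function.Injective fun p : Fin 3 × Fin 3 => M p.1 p.2) ∧
      t = 3 * M 1 1 ∧ M 0 0 + M 2 2 = 2 * M 1 1 ∧ M 0 2 + M 2 0 = 2 * M 1 1 ∧
      M 0 0 + M 0 1 + M 0 2 = 3 * M 1 1 ∧ M 0 1 + M 2 1 = 2 * M 1 1 ∧
      M 0 0 + M 1 0 + M 2 0 = 3 * M 1 1 ∧ M 1 0 + M 1 2 = 2 * M 1 1 := by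
  simp only [IsMagicSquare3, Fin.forall_fin_succ, Fin.sum_univ_three, Fin.isValue]
  refine and_congr_right fun _ => and_congr_right fun _ => ?_
  simp
  omega

lemma a3_three_mul (c : ℕ) : a3 (3 * c) = (offsets c).card := by
  rw [a3, ← Set.ncard_coe_finset]
  refine Set.ncard_congr (fun M _ => ((M 0 0 : ℤ) - M 1 1, (M 0 2 : ℤ) - M 1 1)) ?_ ?_ ?_
  · intro M hM
    obtain ⟨hpos, hinj, h⟩ := (isMagicSquare3_iff _ _).1 hM
    have hne (i j k l : Fin 3) (hij : (i, j) ≠ (k, l)) : M i j ≠ M k l := hinj.ne hij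
    have h1 := hne 0 0 1 1 (by decide)
    have h2 := hne 0 2 1 1 (by decide)
    have h3 := hne 0 0 0 2 (by decide)
    have h4 := hne 0 0 2 0 (by decide)
    have h5 := hne 0 1 0 2 (by decide)
    have h6 := hne 0 1 0 0 (by decide)
    have h7 := hne 1 0 0 0 (by decide)
    have h8 := hne 1 0 2 0 (by decide)
    have p1 := hpos 0 1
    have p2 := hpos 1 0
    have p3 := hpos 1 2
    have p4 := hpos 2 1
    simp only [Finset.mem_coe, mem_offsets, Nondegenerate]
    omega
  · intro M N hM hN h
    obtain ⟨-, -, hM⟩ := (isMagicSquare3_iff _ _).1 hM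
    obtain ⟨-, -, hN⟩ := (isMagicSquare3_iff _ _).1 hN
    simp only [Prod.mk.injEq] at h
    ext i j
    fin_cases i <;> fin_cases j <;> simp only [Fin.zero_eta, Fin.mk_one, Fin.reduceFinMk] <;> omega
  · rintro ⟨a, b⟩ h
    simp only [Finset.mem_coe, mem_offsets, Nondegenerate] at h
    refine ⟨!![(c + a).toNat, (c - a - b).toNat, (c + b).toNat;
      (c - a + b).toNat, c, (c + a - b).toNat;
      (c - b).toNat, (c + a + b).toNat, (c - a).toNat], ?_, ?_⟩
    · refine (isMagicSquare3_iff _ _).2 ⟨?_, ?_, ?_⟩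
      · intro i j
        fin_cases i <;> fin_cases j <;> simp <;> omega
      · rintro ⟨i, j⟩ ⟨k, l⟩ hM
        fin_cases i <;> fin_cases j <;> fin_cases k <;> fin_cases l <;> simp at hM ⊢ <;> omega
      · simp
        omega
    · simp
      omega

lemma a3_eq_zero {t : ℕ} (ht : t % 3 ≠ 0) : a3 t = 0 := by
  suffices h : {M | IsMagicSquare3 t M} = ∅ by rw [a3, h, Set.ncard_empty]
  rw [Set.eq_empty_iff_forall_notMem]
  intro M hM
  have := (isMagicSquare3_iff _ _).1 hM
  omega

/-- The difference `a3 t - a3 (t - 3)`. -/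
def increment (t : ℕ) : ℕ :=
  if t % 3 = 0 then 8 * ((t / 3 - 2) / 2 + (t / 3 - 2) / 3 - (t / 3 - 1) / 3) else 0

lemma a3_add_three (t : ℕ) : a3 (t + 3) = a3 t + increment (t + 3) := by
  by_cases ht : t % 3 = 0
  · obtain ⟨c, rfl⟩ := Nat.dvd_of_mod_eq_zero ht
    rw [show 3 * c + 3 = 3 * (c + 1) by ring, a3_three_mul, a3_three_mul, card_offsets_succ,
      card_shell, card_shellAbs, increment, if_pos (Nat.mul_mod_right 3 _),
      Nat.mul_div_cancel_left _ three_pos]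
    rcases c with - | n
    · rfl
    · obtain ⟨k, r, hr, rfl⟩ : ∃ k r, r < 6 ∧ n = 6 * k + r :=
        ⟨n / 6, n % 6, Nat.mod_lt _ (by norm_num), (Nat.div_add_mod n 6).symm⟩
      interval_cases r <;> split_ifs <;> omega
  · rw [a3_eq_zero ht, a3_eq_zero (by omega), increment, if_neg (by omega)]

lemma a3_of_lt_three {t : ℕ} (ht : t < 3) : a3 t = 0 := by
  rcases Nat.eq_zero_or_pos t with rfl | h
  · exact a3_three_mul 0
  · exact a3_eq_zero (by omega)

lemma increment_of_lt_three {t : ℕ} (ht : t < 3) : increment t = 0 := by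
  interval_cases t <;> rfl

open PowerSeries in
lemma one_sub_X_pow_three_mul_mk_a3 :
    (1 - (X : PowerSeries ℚ) ^ 3) * mk (fun t => (a3 t : ℚ)) =
      mk (fun t => (increment t : ℚ)) := by
  ext t
  rw [sub_mul, one_mul, map_sub, coeff_X_pow_mul', coeff_mk, coeff_mk, coeff_mk]
  split_ifs with h
  · obtain ⟨s, rfl⟩ := Nat.exists_eq_add_of_le' h
    rw [a3_add_three, Nat.add_sub_cancel]
    push_cast
    ring
  · rw [a3_of_lt_three (by omega), increment_of_lt_three (by omega), Nat.cast_zero, sub_zero]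

lemma increment_recurrence (t : ℕ) :
    increment t + (if 15 ≤ t then increment (t - 15) else 0) =
      (if 6 ≤ t then increment (t - 6) else 0) + (if 9 ≤ t then increment (t - 9) else 0) +
      ((if t = 18 then 16 else 0) + (if t = 15 then 8 else 0)) := by
  by_cases ht : t < 19
  · interval_cases t <;> rfl
  · rw [if_pos (by omega), if_pos (by omega), if_pos (by omega), if_neg (by omega),
      if_neg (by omega)]
    by_cases h : t % 3 = 0
    · obtain ⟨s, rfl⟩ := Nat.dvd_of_mod_eq_zero h
      simp only [increment]
      rw [if_pos (by omega), if_pos (by omega), if_pos (by omega), if_pos (by omega)]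
      obtain ⟨c, rfl⟩ := Nat.exists_eq_add_of_le' (show 7 ≤ s by omega)
      omega
    · simp only [increment]
      rw [if_neg (by omega), if_neg (by omega), if_neg (by omega), if_neg (by omega)]

open PowerSeries in
lemma mul_mk_increment :
    (1 - (X : PowerSeries ℚ) ^ 6) * (1 - X ^ 9) * mk (fun t => (increment t : ℚ)) =
      8 * X ^ 15 * (2 * X ^ 3 + 1) := by
  set F : PowerSeries ℚ := mk (fun t => (increment t : ℚ)) with hF
  have h : F + X ^ 15 * F = X ^ 6 * F + X ^ 9 * F + (C 16 * X ^ 18 + C 8 * X ^ 15) := by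
    ext t
    have := congrArg (Nat.cast : ℕ → ℚ) (increment_recurrence t)
    push_cast at this
    simpa only [map_add, coeff_X_pow_mul', hF, coeff_mk, coeff_C_mul, coeff_X_pow, mul_ite,
      mul_one, mul_zero] using this
  have h16 : (C 16 : PowerSeries ℚ) = 16 := map_ofNat C 16
  have h8 : (C 8 : PowerSeries ℚ) = 8 := map_ofNat C 8
  rw [h16, h8] at h
  linear_combination h

end MagicSquare3

open PowerSeries in
theorem a3_generating_function :
    (1 - (PowerSeries.X : PowerSeries ℚ) ^ 3) * (1 - PowerSeries.X ^ 6) *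
        (1 - PowerSeries.X ^ 9) * PowerSeries.mk (fun t => (a3 t : ℚ)) =
      8 * PowerSeries.X ^ 15 * (2 * PowerSeries.X ^ 3 + 1) := by
  rw [← MagicSquare3.mul_mk_increment, ← MagicSquare3.one_sub_X_pow_three_mul_mk_a3]
  ring
end
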